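/- Fix coprime integers n, d with 0 < d < n, and let A = Mat_{n×n}(ℂ). For v ≠ 0 and y₁ ≠ y₂ let r_{(n,d)}(v;y₁,y₂) = can⁻¹(ev_{y₂} ∘ res_{y₁}⁻¹) ∈ A⊗A, where res_{y₁}, ev_{y₂} : Sol_{n,d}^{v,y₁} → A are the linear isomorphisms F ↦ F(y₁) and F ↦ (1/(y₂−y₁))·F(y₂), and can : A⊗A → End_ℂ(A) is the isomorphism X⊗Y ↦ (Z ↦ tr(XZ)·Y). Then r_{(n,d)} is a non-degenerate unitary solution of the AYBE; moreover, r_{(n,d)} is holomorphic on ℂ³ ∖ {(v,y₁,y₂) : v·(y₁−y₂) = 0}. -/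

import Mathlib

open Matrix Kronecker Filter Topology Set

noncomputable section

attribute [local instance] Matrix.normedAddCommGroup Matrix.normedSpace

abbrev Mat (n : ℕ) : Type := Matrix (Fin n) (Fin n) ℂ
abbrev T2 (n : ℕ) : Type := Matrix (Fin n × Fin n) (Fin n × Fin n) ℂ
abbrev T3 (n : ℕ) : Type := Matrix (Fin n × Fin n × Fin n) (Fin n × Fin n × Fin n) ℂ

/-- The embedding `t ↦ t^{12}` of `A ⊗ A` into `A ⊗ A ⊗ A`. -/
def emb12 {n : ℕ} (t : T2 n) : T3 n :=
  Matrix.of fun p q => t (p.1, p.2.1) (q.1, q.2.1) * (if p.2.2 = q.2.2 then 1 else 0)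

/-- The embedding `t ↦ t^{13}` of `A ⊗ A` into `A ⊗ A ⊗ A`. -/
def emb13 {n : ℕ} (t : T2 n) : T3 n :=
  Matrix.of fun p q => t (p.1, p.2.2) (q.1, q.2.2) * (if p.2.1 = q.2.1 then 1 else 0)

/-- The embedding `t ↦ t^{23}` of `A ⊗ A` into `A ⊗ A ⊗ A`. -/
def emb23 {n : ℕ} (t : T2 n) : T3 n :=
  Matrix.of fun p q => t (p.2.1, p.2.2) (q.2.1, q.2.2) * (if p.1 = q.1 then 1 else 0)

/-- The flip `t ↦ t^{21}` on `A ⊗ A`. -/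
def tflip {n : ℕ} (t : T2 n) : T2 n :=
  Matrix.of fun p q => t (p.2, p.1) (q.2, q.1)

/-- The associative Yang–Baxter equation with three spectral parameters. -/
def IsAYBESolution {n : ℕ} (r : ℂ → ℂ → ℂ → T2 n) : Prop :=
  ∀ u v y₁ y₂ y₃ : ℂ, u ≠ 0 → v ≠ 0 → u + v ≠ 0 → y₁ ≠ y₂ → y₁ ≠ y₃ → y₂ ≠ y₃ →
    emb12 (r u y₁ y₂) * emb23 (r (u + v) y₂ y₃) =
      emb13 (r (u + v) y₁ y₃) * emb12 (r (-v) y₁ y₂) + emb23 (r v y₂ y₃) * emb13 (r u y₁ y₃)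

/-- Unitarity: `r^{21}(-v; y₂, y₁) = - r(v; y₁, y₂)`. -/
def IsUnitarySolution {n : ℕ} (r : ℂ → ℂ → ℂ → T2 n) : Prop :=
  ∀ v y₁ y₂ : ℂ, v ≠ 0 → y₁ ≠ y₂ → tflip (r (-v) y₂ y₁) = - r v y₁ y₂

/-- `can : A ⊗ A → End(A)`, `X ⊗ Y ↦ (Z ↦ tr(XZ)·Y)`. -/
def canMap {n : ℕ} (t : T2 n) (Z : Mat n) : Mat n :=
  Matrix.of fun k l => ∑ i, ∑ j, t (i, k) (j, l) * Z j i

/-- Non-degeneracy: on a dense subset of the domain the tensor is invertible under `can`. -/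
def IsNonDegenerate {n : ℕ} (r : ℂ → ℂ → ℂ → T2 n) : Prop :=
  {p : ℂ × ℂ × ℂ | p.1 ≠ 0 ∧ p.2.1 ≠ p.2.2} ⊆
    closure {p : ℂ × ℂ × ℂ | p.1 ≠ 0 ∧ p.2.1 ≠ p.2.2 ∧
      Function.Bijective (canMap (r p.1 p.2.1 p.2.2))}

/-- `r` is holomorphic on `{(v,y₁,y₂) : v ≠ 0, y₁ ≠ y₂}`. -/
def IsHolomorphicOnDomain {n : ℕ} (r : ℂ → ℂ → ℂ → T2 n) : Prop :=
  DifferentiableOn ℂ (fun p : ℂ × ℂ × ℂ => r p.1 p.2.1 p.2.2)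
    {p : ℂ × ℂ × ℂ | p.1 ≠ 0 ∧ p.2.1 ≠ p.2.2}

/-- `r` is of the form (*): `r(v;y₁,y₂) = v⁻¹·1⊗1 + r₀(y₁,y₂) + v·r₁(y₁,y₂) + …`,
with Taylor coefficients `rc k`. -/
def HasLaurentForm {n : ℕ} (r : ℂ → ℂ → ℂ → T2 n) (rc : ℕ → ℂ → ℂ → T2 n) : Prop :=
  ∀ y₁ y₂ : ℂ, y₁ ≠ y₂ → ∃ ε > 0, ∀ v : ℂ, v ≠ 0 → ‖v‖ < ε →
    HasSum (fun k : ℕ => v ^ k • rc k y₁ y₂) (r v y₁ y₂ - v⁻¹ • 1)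

/-- `r` is meromorphic along the diagonal. -/
def IsMeromorphicAlongDiagonal {n : ℕ} (r : ℂ → ℂ → ℂ → T2 n) : Prop :=
  ∀ u : ℂ, u ≠ 0 → ∀ y₁ : ℂ, MeromorphicAt (fun y₂ => r u y₁ y₂) y₁

/-- `pr ⊗ id` on `A ⊗ A`, where `pr X = X - (tr X / n)·1`. -/
def prLeft {n : ℕ} (t : T2 n) : T2 n :=
  Matrix.of fun p q => t p q - if p.1 = q.1 then (∑ m, t (m, p.2) (m, q.2)) / (n : ℂ) else 0

/-- `id ⊗ pr` on `A ⊗ A`. -/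
def prRight {n : ℕ} (t : T2 n) : T2 n :=
  Matrix.of fun p q => t p q - if p.2 = q.2 then (∑ m, t (p.1, m) (q.1, m)) / (n : ℂ) else 0

/-- `pr ⊗ pr` on `A ⊗ A`. -/
def prTensorPr {n : ℕ} (t : T2 n) : T2 n := prLeft (prRight t)

/-- `c` has no infinitesimal symmetries: the only traceless `a` with
`[c(y₁,y₂), a⊗1 + 1⊗a] = 0` for all `y₁ ≠ y₂` is `a = 0`. -/
def HasNoInfinitesimalSymmetry {n : ℕ} (c : ℂ → ℂ → T2 n) : Prop :=
  ∀ a : Mat n, a.trace = 0 →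
    (∀ y₁ y₂ : ℂ, y₁ ≠ y₂ →
      c y₁ y₂ * (a ⊗ₖ (1 : Mat n) + (1 : Mat n) ⊗ₖ a) =
        (a ⊗ₖ (1 : Mat n) + (1 : Mat n) ⊗ₖ a) * c y₁ y₂) → a = 0

/-- The quantum Yang–Baxter equation. -/
def SatisfiesQYBE {n : ℕ} (q : ℂ → ℂ → T2 n) : Prop :=
  ∀ y₁ y₂ y₃ : ℂ, y₁ ≠ y₂ → y₁ ≠ y₃ → y₂ ≠ y₃ →
    emb12 (q y₁ y₂) * emb13 (q y₁ y₃) * emb23 (q y₂ y₃) =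
      emb23 (q y₂ y₃) * emb13 (q y₁ y₃) * emb12 (q y₁ y₂)

/-- The permutation tensor `P = Σ e_{ij} ⊗ e_{ji}`. -/
def Pmat (n : ℕ) : T2 n :=
  ∑ i : Fin n, ∑ j : Fin n,
    Matrix.single i j (1 : ℂ) ⊗ₖ Matrix.single j i (1 : ℂ)

/-- The matrix `J(a,b)`, defined recursively: `J(1,1) = e₁₂`, and
if `J(a,b)` has blocks `J₁,J₂,J₃`, then `J(a,a+b) = [0,1,0; 0,J₁,J₂; 0,0,J₃]`
(block sizes `a,a,b`) and `J(a+b,b) = [J₁,J₂,0; 0,J₃,1; 0,0,0]` (block sizes `a,b,b`). -/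
def Jmat (a b : ℕ) : Matrix (Fin (a + b)) (Fin (a + b)) ℂ :=
  if h : 0 < a ∧ a < b then
    -- J(a, b) with a < b arises from J(a, b - a) by the rule J(a, a+b') = [0,1,0;0,J₁,J₂;0,0,J₃]
    have e1 : a + (a + (b - a)) = a + b := by omega
    Matrix.reindex (finSumFinEquiv.trans (finCongr e1))
      (finSumFinEquiv.trans (finCongr e1))
      (Matrix.fromBlocks 0
        (Matrix.of fun (i : Fin a) (j : Fin (a + (b - a))) => if (j : ℕ) = (i : ℕ) then 1 else 0)
        0 (Jmat a (b - a)))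
  else if h' : 0 < b ∧ b < a then
    -- J(a, b) with b < a arises from J(a - b, b) by the rule J(a'+b, b) = [J₁,J₂,0;0,J₃,1;0,0,0]
    have e2 : (a - b + b) + b = a + b := by omega
    Matrix.reindex (finSumFinEquiv.trans (finCongr e2))
      (finSumFinEquiv.trans (finCongr e2))
      (Matrix.fromBlocks (Jmat (a - b) b)
        (Matrix.of fun (i : Fin (a - b + b)) (j : Fin b) =>
          if (i : ℕ) = (a - b) + (j : ℕ) then 1 else 0)
        0 0)
  else
    Matrix.of fun i j => if (i : ℕ) = 0 ∧ (j : ℕ) = 1 then 1 else 0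
termination_by a + b
decreasing_by all_goals omega

/-- `J = J(n-d, d)`, viewed as an `n × n` matrix. -/
def Jnd (n d : ℕ) : Mat n :=
  if h : d ≤ n then
    Matrix.reindex (finCongr (by omega)) (finCongr (by omega)) (Jmat (n - d) d)
  else 1

/-- Membership in `W_{n,d}`: a triple of coefficients `(C₀, C₁, C₂)` of a quadratic matrix
polynomial `F(z) = C₀ + C₁ z + C₂ z²`, where (for the block partition of sizes `(n-d, d)`)
the top-right block of `C₁` vanishes and all blocks of `C₂` except the bottom-left vanish. -/
def MemW (n d : ℕ) (F : Mat n × Mat n × Mat n) : Prop :=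
  (∀ i j : Fin n, (i : ℕ) < n - d → ¬ (j : ℕ) < n - d → F.2.1 i j = 0) ∧
  (∀ i j : Fin n, ((i : ℕ) < n - d ∨ ¬ (j : ℕ) < n - d) → F.2.2 i j = 0)

/-- `F₀ = [[W', X], [Y'', Z']]`. -/
def Fzero (n d : ℕ) (F : Mat n × Mat n × Mat n) : Mat n :=
  Matrix.of fun i j =>
    if (i : ℕ) < n - d ∧ ¬ (j : ℕ) < n - d then F.1 i j
    else if ¬ (i : ℕ) < n - d ∧ (j : ℕ) < n - d then F.2.2 i j
    else F.2.1 i j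

/-- `F_ε = [[W, 0], [Y', Z]]`. -/
def Feps (n d : ℕ) (F : Mat n × Mat n × Mat n) : Mat n :=
  Matrix.of fun i j =>
    if (i : ℕ) < n - d ∧ ¬ (j : ℕ) < n - d then 0
    else if ¬ (i : ℕ) < n - d ∧ (j : ℕ) < n - d then F.2.1 i j
    else F.1 i j

/-- The subspace `Sol_{n,d}^{v,y₁} = {F ∈ W_{n,d} : [F₀,J] + (y₁−v)F₀ + F_ε = 0}`. -/
def SolSpace (n d : ℕ) (v y₁ : ℂ) : Submodule ℂ (Mat n × Mat n × Mat n) where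
  carrier := {F | MemW n d F ∧
    (Fzero n d F * Jnd n d - Jnd n d * Fzero n d F) + (y₁ - v) • Fzero n d F + Feps n d F = 0}
  add_mem' := by
    rintro F G ⟨⟨hF1, hF2⟩, hF⟩ ⟨⟨hG1, hG2⟩, hG⟩
    have h0 : Fzero n d (F + G) = Fzero n d F + Fzero n d G := by
      ext i j; simp only [Fzero, Matrix.of_apply, Prod.fst_add, Prod.snd_add, Matrix.add_apply]
      split_ifs <;> simp
    have he : Feps n d (F + G) = Feps n d F + Feps n d G := by
      ext i j; simp only [Feps, Matrix.of_apply, Prod.fst_add, Prod.snd_add, Matrix.add_apply]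
      split_ifs <;> simp
    refine ⟨⟨fun i j hi hj => ?_, fun i j hij => ?_⟩, ?_⟩
    · simp [hF1 i j hi hj, hG1 i j hi hj]
    · simp [hF2 i j hij, hG2 i j hij]
    · rw [h0, he]
      rw [add_mul, mul_add, smul_add]
      have := congrArg₂ (· + ·) hF hG
      simp only [add_zero] at this
      rw [← this]; ring_nf
      abel
  zero_mem' := by
    have h0 : Fzero n d 0 = 0 := by
      ext i j; simp only [Fzero, Matrix.of_apply, Prod.fst_zero, Prod.snd_zero, Matrix.zero_apply]
      split_ifs <;> rfl
    have he : Feps n d 0 = 0 := by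
      ext i j; simp only [Feps, Matrix.of_apply, Prod.fst_zero, Prod.snd_zero, Matrix.zero_apply]
      split_ifs <;> rfl
    exact ⟨⟨fun i j _ _ => rfl, fun i j _ => rfl⟩, by simp [h0, he]⟩
  smul_mem' := by
    rintro c F ⟨⟨hF1, hF2⟩, hF⟩
    have h0 : Fzero n d (c • F) = c • Fzero n d F := by
      ext i j; simp only [Fzero, Matrix.of_apply, Prod.smul_fst, Prod.smul_snd, Matrix.smul_apply]
      split_ifs <;> simp
    have he : Feps n d (c • F) = c • Feps n d F := by
      ext i j; simp only [Feps, Matrix.of_apply, Prod.smul_fst, Prod.smul_snd, Matrix.smul_apply]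
      split_ifs <;> simp
    refine ⟨⟨fun i j hi hj => ?_, fun i j hij => ?_⟩, ?_⟩
    · simp [Prod.smul_snd, hF1 i j hi hj]
    · simp [Prod.smul_snd, hF2 i j hij]
    · rw [h0, he, Matrix.smul_mul, Matrix.mul_smul, smul_comm (y₁ - v) c, ← smul_sub, ← smul_add,
        ← smul_add, hF, smul_zero]

/-- Evaluation of the quadratic matrix polynomial `F(z) = C₀ + C₁ z + C₂ z²`. -/
def evalF {n : ℕ} (F : Mat n × Mat n × Mat n) (z : ℂ) : Mat n :=
  F.1 + z • F.2.1 + z ^ 2 • F.2.2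



/-- Rigidity property used in the induction over the Euclidean algorithm. -/
def Good {ι : Type} [Fintype ι] (J : Matrix ι ι ℂ) (t : ι → Prop) : Prop :=
  ∀ (p q : ℕ) (v : ℂ), 0 < p → 0 < q → v ≠ 0 → ∀ G : Matrix ι ι ℂ,
    (∀ i j, t i → ¬ t j → G i j = 0) →
    (∀ i j, t i → ¬ t j → (G * J - J * G) i j = 0) →
    (∀ i j, t i → t j → (G * J - J * G) i j = p * v * G i j) →
    (∀ i j, ¬ t i → ¬ t j → (G * J - J * G) i j = q * v * G i j) → G = 0

theorem Good.reindex {ι κ : Type} [Fintype ι] [Fintype κ] {J : Matrix ι ι ℂ} {t : ι → Prop}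
    (h : Good J t) (e : ι ≃ κ) (s : κ → Prop) (hs : ∀ i, s (e i) ↔ t i) :
    Good (Matrix.reindex e e J) s := by
  intro p q v hp hq hv G h1 h2 h3 h4
  have key : G.submatrix e e * J - J * G.submatrix e e =
      (G * Matrix.reindex e e J - Matrix.reindex e e J * G).submatrix e e := by
    have hJ : J = (Matrix.reindex e e J).submatrix e e := by
      ext i j; simp
    conv_lhs => rw [hJ]
    rw [Matrix.submatrix_mul_equiv, Matrix.submatrix_mul_equiv]
    rfl
  have := h p q v hp hq hv (G.submatrix e e)
    (fun i j hi hj => h1 _ _ ((hs i).2 hi) (fun h => hj ((hs j).1 h)))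
    (fun i j hi hj => by
      rw [key]; exact h2 _ _ ((hs i).2 hi) (fun h => hj ((hs j).1 h)))
    (fun i j hi hj => by
      rw [key]; exact h3 _ _ ((hs i).2 hi) ((hs j).2 hj))
    (fun i j hi hj => by
      rw [key]; exact h4 _ _ (fun h => hi ((hs i).1 h)) (fun h => hj ((hs j).1 h)))
  ext i j
  have h5 := congrFun (congrFun this (e.symm i)) (e.symm j)
  simpa using h5

theorem good_step1 {κ ι : Type} [Fintype κ] [Fintype ι] [DecidableEq κ] [DecidableEq ι]
    {J : Matrix ι ι ℂ} {t : ι → Prop} (h : Good J t) (f : κ → ι) (hf : Function.Injective f)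
    (ht : ∀ i, t i ↔ ∃ k, f k = i) :
    Good (Matrix.fromBlocks 0 (Matrix.of fun (k : κ) (i : ι) => if i = f k then (1 : ℂ) else 0) 0 J :
      Matrix (κ ⊕ ι) (κ ⊕ ι) ℂ) (fun x => x.isLeft = true) := by
  intro p q v hp hq hv G h1 h2 h3 h4
  obtain ⟨P, X, Q, R, rfl⟩ : ∃ P X Q R, G = Matrix.fromBlocks P X Q R :=
    ⟨_, _, _, _, (Matrix.fromBlocks_toBlocks G).symm⟩
  set I : Matrix κ ι ℂ := Matrix.of fun (k : κ) (i : ι) => if i = f k then (1 : ℂ) else 0 with hI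
  have hX : X = 0 := by
    ext i j; simpa using h1 (Sum.inl i) (Sum.inr j) (by simp) (by simp)
  subst hX
  have hIR : ∀ {μ : Type} (M : Matrix ι μ ℂ) k j, (I * M) k j = M (f k) j := by
    intro μ M k j; simp [hI, Matrix.mul_apply]
  have hPI : ∀ {μ : Type} (M : Matrix μ κ ℂ) i k, (M * I) i (f k) = M i k := by
    intro μ M i k; simp [hI, Matrix.mul_apply, hf.eq_iff]
  have hPI' : ∀ {μ : Type} (M : Matrix μ κ ℂ) i j, ¬ t j → (M * I) i j = 0 := by
    intro μ M i j hj
    rw [Matrix.mul_apply]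
    refine Finset.sum_eq_zero fun k _ => ?_
    have : j ≠ f k := fun h => hj ((ht j).2 ⟨k, h.symm⟩)
    simp [hI, this]
  rw [Matrix.fromBlocks_multiply, Matrix.fromBlocks_multiply] at h2 h3 h4
  have e2 : ∀ i j, (P * I) i j = (I * R) i j := by
    intro i j
    have := h2 (Sum.inl i) (Sum.inr j) (by simp) (by simp)
    simpa [sub_eq_zero] using this
  have e3 : ∀ i j, - (I * Q) i j = p * v * P i j := by
    intro i j
    have := h3 (Sum.inl i) (Sum.inl j) (by simp) (by simp)
    simpa using this
  have e4 : ∀ i j, (Q * I) i j + (R * J - J * R) i j = q * v * R i j := by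
    intro i j
    have := h4 (Sum.inr i) (Sum.inr j) (by simp) (by simp)
    simp at this
    rw [← this, Matrix.sub_apply]; ring
  have r1 : ∀ k l, R (f k) (f l) = P k l := by
    intro k l; rw [← hIR R, ← e2, hPI]
  have r2 : ∀ k j, ¬ t j → R (f k) j = 0 := by
    intro k j hj; rw [← hIR R, ← e2, hPI' _ _ _ hj]
  have q1 : ∀ k l, Q (f k) l = - (p * v * P k l) := by
    intro k l; rw [← e3, hIR]; ring
  have hR : R = 0 := by
    refine h (p + q) q v (by omega) hq hv R ?_ ?_ ?_ ?_
    · intro i j hi hj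
      obtain ⟨k, rfl⟩ := (ht i).1 hi
      exact r2 k j hj
    · intro i j hi hj
      obtain ⟨k, rfl⟩ := (ht i).1 hi
      have := e4 (f k) j
      rw [hPI' _ _ _ hj, r2 k j hj] at this
      simpa using this
    · intro i j hi hj
      obtain ⟨k, rfl⟩ := (ht i).1 hi
      obtain ⟨l, rfl⟩ := (ht j).1 hj
      have := e4 (f k) (f l)
      rw [hPI, q1, r1] at this
      rw [r1]; push_cast; linear_combination this
    · intro i j hi hj
      have := e4 i j
      rw [hPI' _ _ _ hj] at this
      simpa using this
  subst hR
  have hP : P = 0 := by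
    ext k l; rw [← r1]; rfl
  have hQ : Q = 0 := by
    ext i l
    have := e4 i (f l)
    rw [hPI] at this
    simpa using this
  rw [hP, hQ]; simp

theorem good_step2 {κ ι : Type} [Fintype κ] [Fintype ι] [DecidableEq κ] [DecidableEq ι]
    {J : Matrix ι ι ℂ} {t : ι → Prop} (h : Good J t) (f : κ → ι) (hf : Function.Injective f)
    (ht : ∀ i, ¬ t i ↔ ∃ k, f k = i) :
    Good (Matrix.fromBlocks J (Matrix.of fun (i : ι) (k : κ) => if i = f k then (1 : ℂ) else 0) 0 0 :
      Matrix (ι ⊕ κ) (ι ⊕ κ) ℂ) (fun x => x.isLeft = true) := by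
  intro p q v hp hq hv G h1 h2 h3 h4
  obtain ⟨P, X, Q, R, rfl⟩ : ∃ P X Q R, G = Matrix.fromBlocks P X Q R :=
    ⟨_, _, _, _, (Matrix.fromBlocks_toBlocks G).symm⟩
  set I : Matrix ι κ ℂ := Matrix.of fun (i : ι) (k : κ) => if i = f k then (1 : ℂ) else 0 with hI
  have hX : X = 0 := by
    ext i j; simpa using h1 (Sum.inl i) (Sum.inr j) (by simp) (by simp)
  subst hX
  have hPI : ∀ {μ : Type} (M : Matrix μ ι ℂ) k j, (M * I) k j = M k (f j) := by
    intro μ M k j; simp [hI, Matrix.mul_apply]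
  have hIR : ∀ {μ : Type} (M : Matrix κ μ ℂ) i k, (I * M) (f k) i = M k i := by
    intro μ M i k; simp [hI, Matrix.mul_apply, hf.eq_iff]
  have hIR' : ∀ {μ : Type} (M : Matrix κ μ ℂ) i j, t j → (I * M) j i = 0 := by
    intro μ M i j hj
    rw [Matrix.mul_apply]
    refine Finset.sum_eq_zero fun k _ => ?_
    have : j ≠ f k := fun h => ((ht j).2 ⟨k, h.symm⟩) hj
    simp [hI, this]
  rw [Matrix.fromBlocks_multiply, Matrix.fromBlocks_multiply] at h2 h3 h4
  have e2 : ∀ i j, (P * I) i j = (I * R) i j := by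
    intro i j
    have := h2 (Sum.inl i) (Sum.inr j) (by simp) (by simp)
    simpa [sub_eq_zero] using this
  have e3 : ∀ i j, (P * J - J * P) i j - (I * Q) i j = p * v * P i j := by
    intro i j
    have := h3 (Sum.inl i) (Sum.inl j) (by simp) (by simp)
    simp at this
    rw [← this, Matrix.sub_apply]; ring
  have e4 : ∀ i j, (Q * I) i j = q * v * R i j := by
    intro i j
    have := h4 (Sum.inr i) (Sum.inr j) (by simp) (by simp)
    simpa using this
  have r1 : ∀ k l, P (f k) (f l) = R k l := by
    intro k l; rw [← hPI P, e2, hIR]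
  have r2 : ∀ k i, t i → P i (f k) = 0 := by
    intro k i hi; rw [← hPI P, e2, hIR' _ _ _ hi]
  have q1 : ∀ k l, Q k (f l) = q * v * R k l := by
    intro k l; rw [← e4, hPI]
  have hP : P = 0 := by
    refine h p (p + q) v hp (by omega) hv P ?_ ?_ ?_ ?_
    · intro i j hi hj
      obtain ⟨k, rfl⟩ := (ht j).1 hj
      exact r2 k i hi
    · intro i j hi hj
      obtain ⟨k, rfl⟩ := (ht j).1 hj
      have := e3 i (f k)
      rw [hIR' _ _ _ hi, r2 k i hi] at this
      simpa using this
    · intro i j hi hj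
      have := e3 i j
      rw [hIR' _ _ _ hi] at this
      simpa using this
    · intro i j hi hj
      obtain ⟨k, rfl⟩ := (ht i).1 hi
      obtain ⟨l, rfl⟩ := (ht j).1 hj
      have := e3 (f k) (f l)
      rw [hIR, q1, r1] at this
      rw [r1]; push_cast; linear_combination this
  subst hP
  have hR : R = 0 := by
    ext k l; rw [← r1]; rfl
  have hQ : Q = 0 := by
    ext l i
    have := e3 (f l) i
    rw [hIR] at this
    simpa using this
  rw [hR, hQ]; simp

theorem good_base : Good (Jmat 1 1) (fun i => (i : ℕ) < 1) := by
  intro p q v hp hq hv G h1 h2 h3 h4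
  have hJ : Jmat 1 1 = !![0, 1; 0, 0] := by
    rw [Jmat]
    ext i j
    fin_cases i <;> fin_cases j <;> simp
  rw [hJ] at h2 h3 h4
  have a1 := h1 0 1 (by simp) (by simp)
  have a2 := h2 0 1 (by simp) (by simp)
  have a3 := h3 0 0 (by simp) (by simp)
  have a4 := h4 1 1 (by simp) (by simp)
  simp [Matrix.mul_apply, Fin.sum_univ_two, Matrix.sub_apply, Matrix.vecMul, dotProduct] at a1 a2 a3 a4
  have hpq : ((p : ℂ) + q) * v ≠ 0 := by
    refine mul_ne_zero ?_ hv
    exact_mod_cast (by omega : p + q ≠ 0)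
  have h00 : G 0 0 = 0 := by
    have : ((p : ℂ) + q) * v * G 0 0 = 0 := by
      linear_combination (-1 : ℂ) * a3 - a4 + q * v * a2
    exact (mul_eq_zero.1 this).resolve_left hpq
  have h11 : G 1 1 = 0 := by
    rw [h00] at a2; linear_combination -a2
  have h10 : G 1 0 = 0 := by
    rw [h11] at a4; linear_combination a4
  ext i j
  fin_cases i <;> fin_cases j <;> simp [h00, h11, h10, a1]

theorem good_Jmat (N : ℕ) : ∀ a b : ℕ, a + b = N → 0 < a → 0 < b → Nat.Coprime a b →
    Good (Jmat a b) (fun i => (i : ℕ) < a) := by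
  induction N using Nat.strong_induction_on with
  | _ N ih =>
  intro a b hN ha hb hc
  rcases lt_trichotomy a b with hab | hab | hab
  · have hg := ih (a + (b - a)) (by omega) a (b - a) rfl ha (by omega)
      ((Nat.coprime_sub_self_right hab.le).2 hc)
    rw [Jmat, dif_pos ⟨ha, hab⟩]
    have hs := good_step1 (κ := Fin a) hg (fun k => Fin.castLE (by omega) k)
      (fun x y hxy => by simpa [Fin.ext_iff] using hxy)
      (fun i => ⟨fun hi => ⟨⟨i, hi⟩, by simp⟩, by rintro ⟨k, rfl⟩; simp⟩)
    convert hs.reindex (finSumFinEquiv.trans (finCongr (by omega : a + (a + (b - a)) = a + b)))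
      (fun i => (i : ℕ) < a) ?_ using 4
    · ext i j; simp [Fin.ext_iff]
    · rintro (i | i) <;> simp
  · subst hab
    have : a = 1 := by simpa using hc
    subst this
    exact good_base
  · have hg := ih (a - b + b) (by omega) (a - b) b rfl (by omega) hb
      ((Nat.coprime_sub_self_left hab.le).2 hc)
    rw [Jmat, dif_neg (by omega), dif_pos ⟨hb, hab⟩]
    have hs := good_step2 (κ := Fin b) hg (fun k => Fin.natAdd (a - b) k)
      (fun x y hxy => by simpa [Fin.ext_iff] using hxy)
      (fun i => ⟨fun hi => ⟨⟨i - (a - b), by omega⟩, by ext; simp at hi ⊢; omega⟩,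
        by rintro ⟨k, rfl⟩; simp⟩)
    convert hs.reindex (finSumFinEquiv.trans (finCongr (by omega : (a - b + b) + b = a + b)))
      (fun i => (i : ℕ) < a) ?_ using 4
    · ext i j; simp [Fin.ext_iff]
    · rintro (i | i)
      · simp; omega
      · simp

theorem good_Jnd (n d : ℕ) (hd : 0 < d) (hdn : d < n) (hcop : Nat.Coprime n d) :
    Good (Jnd n d) (fun i => (i : ℕ) < n - d) := by
  have hg := good_Jmat _ (n - d) d rfl (by omega) hd ((Nat.coprime_sub_self_left hdn.le).2 hcop)
  rw [Jnd, dif_pos hdn.le]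
  exact hg.reindex _ _ (fun i => by simp)


set_option linter.unusedSimpArgs false

theorem sol_zero {n d : ℕ} (hd : 0 < d) (hdn : d < n) (hcop : Nat.Coprime n d) {v y₁ y : ℂ}
    {F : Mat n × Mat n × Mat n} (hF : F ∈ SolSpace n d v y₁) (hy : evalF F y = 0)
    (hv : v + y - y₁ ≠ 0) : F = 0 := by
  obtain ⟨⟨w1, w2⟩, hE⟩ := hF
  obtain ⟨A, B, C⟩ := F
  have hev : ∀ i j, A i j + y * B i j + y ^ 2 * C i j = 0 := by
    intro i j
    have := congrFun (congrFun hy i) j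
    simpa [evalF] using this
  have hE' : ∀ i j, (Fzero n d (A, B, C) * Jnd n d - Jnd n d * Fzero n d (A, B, C)) i j
      + (y₁ - v) * Fzero n d (A, B, C) i j + Feps n d (A, B, C) i j = 0 := by
    intro i j
    have := congrFun (congrFun hE i) j
    simpa using this
  simp only at w1 w2
  have hz : Fzero n d (A, B, C) = 0 := by
    refine good_Jnd n d hd hdn hcop 1 1 (v + y - y₁) one_pos one_pos hv _ ?_ ?_ ?_ ?_
    · intro i j hi hj
      have := hev i j
      rw [w1 i j hi hj, w2 i j (Or.inl hi)] at this
      simp only [Fzero, Matrix.of_apply]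
      rw [if_pos ⟨hi, hj⟩]
      linear_combination this
    · intro i j hi hj
      have h := hE' i j
      have := hev i j
      rw [w1 i j hi hj, w2 i j (Or.inl hi)] at this
      have h1 : Fzero n d (A, B, C) i j = 0 := by
        simp only [Fzero, Matrix.of_apply]
        rw [if_pos ⟨hi, hj⟩]
        linear_combination this
      have h2 : Feps n d (A, B, C) i j = 0 := by
        simp only [Feps, Matrix.of_apply]
        rw [if_pos ⟨hi, hj⟩]
      rw [h1, h2] at h
      linear_combination h
    · intro i j hi hj
      have h := hE' i j
      have := hev i j
      rw [w2 i j (Or.inl hi)] at this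
      have h1 : Fzero n d (A, B, C) i j = B i j := by
        simp only [Fzero, Matrix.of_apply]
        rw [if_neg (by tauto), if_neg (by tauto)]
      have h2 : Feps n d (A, B, C) i j = A i j := by
        simp only [Feps, Matrix.of_apply]
        rw [if_neg (by tauto), if_neg (by tauto)]
      rw [h2] at h
      rw [h1] at h ⊢
      push_cast
      linear_combination h - this
    · intro i j hi hj
      have h := hE' i j
      have := hev i j
      rw [w2 i j (Or.inr hj)] at this
      have h1 : Fzero n d (A, B, C) i j = B i j := by
        simp only [Fzero, Matrix.of_apply]
        rw [if_neg (by tauto), if_neg (by tauto)]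
      have h2 : Feps n d (A, B, C) i j = A i j := by
        simp only [Feps, Matrix.of_apply]
        rw [if_neg (by tauto), if_neg (by tauto)]
      rw [h2] at h
      rw [h1] at h ⊢
      push_cast
      linear_combination h - this
  have he : ∀ i j, Feps n d (A, B, C) i j = 0 := by
    intro i j
    have := hE' i j
    rw [hz] at this
    simpa using this
  have hz' : ∀ i j, Fzero n d (A, B, C) i j = 0 := by
    intro i j; rw [hz]; rfl
  simp only [Fzero, Feps, Matrix.of_apply] at he hz'
  have hC : ∀ i j, C i j = 0 := by
    intro i j
    by_cases hi : (i : ℕ) < n - d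
    · exact w2 i j (Or.inl hi)
    · by_cases hj : (j : ℕ) < n - d
      · simpa [hi, hj] using hz' i j
      · exact w2 i j (Or.inr hj)
  have hB : ∀ i j, B i j = 0 := by
    intro i j
    have a1 := hz' i j
    have a2 := he i j
    have a3 := w1 i j
    by_cases hi : (i : ℕ) < n - d <;> by_cases hj : (j : ℕ) < n - d <;> simp_all
  have hA : ∀ i j, A i j = 0 := by
    intro i j
    have := hev i j
    rw [hB, hC] at this
    linear_combination this
  ext i j
  · exact hA i j
  · exact hB i j
  · exact hC i j

theorem memW_trace {n d : ℕ} {F H : Mat n × Mat n × Mat n} (hF : MemW n d F) (hH : MemW n d H)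
    (z : ℂ) : (evalF F z * evalF H z).trace = z ^ 2 * (Fzero n d F * Fzero n d H).trace
      + z * (Fzero n d F * Feps n d H + Feps n d F * Fzero n d H).trace + (F.1 * H.1).trace := by
  obtain ⟨A, B, C⟩ := F
  obtain ⟨A', B', C'⟩ := H
  obtain ⟨f1, f2⟩ := hF
  obtain ⟨g1, g2⟩ := hH
  simp only at f1 f2 g1 g2
  simp only [Matrix.trace, Matrix.diag, Matrix.mul_apply, Matrix.add_apply, Finset.mul_sum,
    ← Finset.sum_add_distrib]
  refine Finset.sum_congr rfl fun i _ => Finset.sum_congr rfl fun k _ => ?_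
  simp only [evalF, Fzero, Feps, Matrix.of_apply, Matrix.add_apply, Matrix.smul_apply, smul_eq_mul]
  have a1 := f1 i k
  have a2 := f2 i k
  have b1 := g1 k i
  have b2 := g2 k i
  by_cases hi : (i : ℕ) < n - d <;> by_cases hk : (k : ℕ) < n - d <;>
    simp only [hi, hk, not_true, not_false_iff, true_or, or_true, or_false, false_or, forall_const,
      and_true, and_false, true_and, false_and, if_true, if_false, IsEmpty.forall_iff] at * <;>
    simp only [a1, a2, b1, b2] <;> ring

theorem sol_trace {n d : ℕ} {v y₁ y₂ : ℂ} {F H : Mat n × Mat n × Mat n}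
    (hF : F ∈ SolSpace n d v y₁) (hH : H ∈ SolSpace n d (-v) y₂) :
    (evalF F y₁ * evalF H y₁).trace = (evalF F y₂ * evalF H y₂).trace := by
  obtain ⟨wF, eF⟩ := hF
  obtain ⟨wH, eH⟩ := hH
  rw [memW_trace wF wH, memW_trace wF wH]
  set X := Fzero n d F
  set Y := Fzero n d H
  set J := Jnd n d
  have e1 : Feps n d F = -(X * J - J * X) - (y₁ - v) • X := by
    rw [eq_sub_iff_add_eq, eq_neg_iff_add_eq_zero, ← eF]; abel
  have e2 : Feps n d H = -(Y * J - J * Y) - (y₂ - -v) • Y := by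
    rw [eq_sub_iff_add_eq, eq_neg_iff_add_eq_zero, ← eH]; abel
  have key : (X * Feps n d H + Feps n d F * Y).trace = -(y₁ + y₂) * (X * Y).trace := by
    rw [e1, e2]
    have c1 : (J * X * Y).trace = (X * Y * J).trace := by
      rw [Matrix.mul_assoc, Matrix.trace_mul_comm]
    simp only [mul_sub, sub_mul, mul_neg, neg_mul, Matrix.trace_add, Matrix.trace_sub,
      Matrix.trace_neg, Matrix.mul_smul, Matrix.smul_mul, Matrix.trace_smul, smul_eq_mul,
      ← Matrix.mul_assoc]
    rw [c1]; ring
  rw [key]; ring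

/-- Leading part of a cubic matrix polynomial. -/
def lead2 (n d : ℕ) (N1 N2 N3 : Mat n) : Mat n :=
  Matrix.of fun i j =>
    if (i : ℕ) < n - d ∧ ¬ (j : ℕ) < n - d then N1 i j
    else if ¬ (i : ℕ) < n - d ∧ (j : ℕ) < n - d then N3 i j
    else N2 i j

theorem prod_lead {n d : ℕ} {A B C A' B' C' : Mat n} (hF : MemW n d (A, B, C))
    (hH : MemW n d (A', B', C')) :
    lead2 n d (A * B' + B * A') (A * C' + B * B' + C * A') (B * C' + C * B') =
      Fzero n d (A, B, C) * Fzero n d (A', B', C') := by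
  obtain ⟨f1, f2⟩ := hF
  obtain ⟨g1, g2⟩ := hH
  simp only at f1 f2 g1 g2
  ext i j
  by_cases hi : (i : ℕ) < n - d <;> by_cases hj : (j : ℕ) < n - d <;>
    simp only [lead2, hi, hj, not_true, not_false_iff, and_true, and_false, true_and, false_and,
      if_true, if_false, Matrix.of_apply, Matrix.mul_apply, Matrix.add_apply,
      ← Finset.sum_add_distrib] <;>
    refine Finset.sum_congr rfl fun k _ => ?_ <;>
    have a1 := f1 i k <;> have a2 := f2 i k <;> have b1 := g1 k j <;> have b2 := g2 k j <;>
    by_cases hk : (k : ℕ) < n - d <;>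
    simp only [Fzero, Matrix.of_apply, hi, hj, hk, not_true, not_false_iff, true_or, or_true,
      or_false, false_or, forall_const,
      and_true, and_false, true_and, false_and, if_true, if_false, IsEmpty.forall_iff] at * <;>
    simp only [a1, a2, b1, b2] <;> ring

theorem prod_eps {n d : ℕ} {A B C A' B' C' : Mat n} (hF : MemW n d (A, B, C))
    (hH : MemW n d (A', B', C')) :
    lead2 n d (A * A') (A * B' + B * A') (A * C' + B * B' + C * A') =
      Fzero n d (A, B, C) * Feps n d (A', B', C') + Feps n d (A, B, C) * Fzero n d (A', B', C') := by
  obtain ⟨f1, f2⟩ := hF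
  obtain ⟨g1, g2⟩ := hH
  simp only at f1 f2 g1 g2
  ext i j
  by_cases hi : (i : ℕ) < n - d <;> by_cases hj : (j : ℕ) < n - d <;>
    simp only [lead2, hi, hj, not_true, not_false_iff, and_true, and_false, true_and, false_and,
      if_true, if_false, Matrix.of_apply, Matrix.mul_apply, Matrix.add_apply,
      ← Finset.sum_add_distrib] <;>
    refine Finset.sum_congr rfl fun k _ => ?_ <;>
    have a1 := f1 i k <;> have a2 := f2 i k <;> have b1 := g1 k j <;> have b2 := g2 k j <;>
    by_cases hk : (k : ℕ) < n - d <;>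
    simp only [Fzero, Feps, Matrix.of_apply, hi, hj, hk, not_true, not_false_iff, true_or, or_true,
      or_false, false_or, forall_const,
      and_true, and_false, true_and, false_and, if_true, if_false, IsEmpty.forall_iff] at * <;>
    try simp only [a1, a2, b1, b2]
  all_goals ring

theorem prod_van {n d : ℕ} {A B C A' B' C' : Mat n} (hF : MemW n d (A, B, C))
    (hH : MemW n d (A', B', C')) :
    MemW n d (0, A * C' + B * B' + C * A', B * C' + C * B') ∧ C * C' = 0 := by
  obtain ⟨f1, f2⟩ := hF
  obtain ⟨g1, g2⟩ := hH
  simp only at f1 f2 g1 g2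
  refine ⟨⟨?_, ?_⟩, ?_⟩
  · intro i j hi hj
    simp only [Matrix.mul_apply, Matrix.add_apply, ← Finset.sum_add_distrib]
    refine Finset.sum_eq_zero fun k _ => ?_
    have a1 := f1 i k; have a2 := f2 i k; have b1 := g1 k j; have b2 := g2 k j
    by_cases hk : (k : ℕ) < n - d <;> simp_all
  · intro i j hij
    simp only [Matrix.mul_apply, Matrix.add_apply, ← Finset.sum_add_distrib]
    refine Finset.sum_eq_zero fun k _ => ?_
    have a1 := f1 i k; have a2 := f2 i k; have b1 := g1 k j; have b2 := g2 k j
    by_cases hk : (k : ℕ) < n - d <;> rcases hij with hi | hj <;> simp_all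
  · ext i j
    simp only [Matrix.mul_apply]
    refine Finset.sum_eq_zero fun k _ => ?_
    have a2 := f2 i k; have b2 := g2 k j
    by_cases hk : (k : ℕ) < n - d <;> simp_all

theorem div_lead {n d : ℕ} (y : ℂ) (N1 N2 N3 : Mat n) (hN : MemW n d (0, N2, N3)) :
    Fzero n d (N1 + y • N2 + y ^ 2 • N3, N2 + y • N3, N3) = lead2 n d N1 N2 N3 := by
  ext i j
  have a1 := hN.1 i j
  have a2 := hN.2 i j
  simp only [Fzero, Feps, lead2, Matrix.of_apply, Matrix.add_apply, Matrix.sub_apply,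
    Matrix.smul_apply, smul_eq_mul]
  split_ifs with h1 h2
  · linear_combination y * a1 h1.1 h1.2 + y ^ 2 * a2 (Or.inl h1.1)
  · ring
  · linear_combination y * a2 (by tauto)

theorem div_eps {n d : ℕ} (y : ℂ) (N0 N1 N2 N3 : Mat n) (hN : MemW n d (0, N2, N3))
    (h0 : ∀ i j, N0 i j + y * N1 i j + y ^ 2 * N2 i j + y ^ 3 * N3 i j = 0) :
    Feps n d (N1 + y • N2 + y ^ 2 • N3, N2 + y • N3, N3) =
        lead2 n d N0 N1 N2 + y • lead2 n d N1 N2 N3 := by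
  ext i j
  have a1 := hN.1 i j
  have a2 := hN.2 i j
  have a3 := h0 i j
  simp only [Fzero, Feps, lead2, Matrix.of_apply, Matrix.add_apply, Matrix.sub_apply,
    Matrix.smul_apply, smul_eq_mul]
  split_ifs with h1 h2
  · linear_combination (-1 : ℂ) * a3 + y ^ 2 * a1 h1.1 h1.2 + y ^ 3 * a2 (Or.inl h1.1)
  · ring
  · linear_combination y ^ 2 * a2 (by tauto)

theorem sub_lead {n d : ℕ} (y : ℂ) (N1 N2 N3 K L M : Mat n) (hN : MemW n d (K, L, M)) :
    lead2 n d (N1 - (K - y • L)) (N2 - (L - y • M)) (N3 - M) =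
      lead2 n d N1 N2 N3 - Fzero n d (K, L, M) := by
  ext i j
  have a1 := hN.1 i j
  have a2 := hN.2 i j
  simp only [Fzero, Feps, lead2, Matrix.of_apply, Matrix.add_apply, Matrix.sub_apply,
    Matrix.smul_apply, smul_eq_mul]
  split_ifs with h1 h2
  · linear_combination y * a1 h1.1 h1.2 + 0 * a2 (Or.inl h1.1)
  · ring
  · linear_combination y * a2 (by tauto)

theorem sub_eps {n d : ℕ} (y : ℂ) (N0 N1 N2 K L M : Mat n) :
    lead2 n d (N0 + y • K) (N1 - (K - y • L)) (N2 - (L - y • M)) =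
      lead2 n d N0 N1 N2 - Feps n d (K, L, M) + y • Fzero n d (K, L, M) := by
  ext i j
  simp only [Fzero, Feps, lead2, Matrix.of_apply, Matrix.add_apply, Matrix.sub_apply,
    Matrix.smul_apply, smul_eq_mul]
  split_ifs with h1 h2
  all_goals ring

theorem division {n d : ℕ} {w y₁ y₂ : ℂ} {N0 N1 N2 N3 : Mat n} (hN : MemW n d (0, N2, N3))
    (hE : lead2 n d N1 N2 N3 * Jnd n d - Jnd n d * lead2 n d N1 N2 N3
      + (y₁ + y₂ - w) • lead2 n d N1 N2 N3 + lead2 n d N0 N1 N2 = 0)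
    (h0 : N0 + y₁ • N1 + y₁ ^ 2 • N2 + y₁ ^ 3 • N3 = 0) :
    ∃ F ∈ SolSpace n d w y₂, ∀ z : ℂ,
      N0 + z • N1 + z ^ 2 • N2 + z ^ 3 • N3 = (z - y₁) • evalF F z := by
  obtain ⟨f1, f2⟩ := hN
  simp only at f1 f2
  have h0' : ∀ i j, N0 i j + y₁ * N1 i j + y₁ ^ 2 * N2 i j + y₁ ^ 3 * N3 i j = 0 := by
    intro i j
    have := congrFun (congrFun h0 i) j
    simpa using this
  refine ⟨(N1 + y₁ • N2 + y₁ ^ 2 • N3, N2 + y₁ • N3, N3), ⟨⟨?_, ?_⟩, ?_⟩, ?_⟩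
  · intro i j hi hj
    simp [f1 i j hi hj, f2 i j (Or.inl hi)]
  · exact f2
  · have e1 := div_lead y₁ N1 N2 N3 ⟨f1, f2⟩
    have e2 := div_eps y₁ N0 N1 N2 N3 ⟨f1, f2⟩ h0'
    rw [e1, e2, ← hE]
    rw [add_sub_assoc, add_smul]
    abel
  · intro z
    ext i j
    simp only [evalF, Matrix.add_apply, Matrix.smul_apply, smul_eq_mul]
    linear_combination h0' i j

theorem sol_prod {n d : ℕ} {u v y₁ y₂ : ℂ} {F H F3 : Mat n × Mat n × Mat n}
    (hF : F ∈ SolSpace n d v y₂) (hH : H ∈ SolSpace n d u y₁) (h3 : F3 ∈ SolSpace n d (u + v) y₁)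
    (hp : (y₁ - y₂) • evalF F3 y₁ = evalF F y₁ * evalF H y₁) :
    ∃ F4 ∈ SolSpace n d (u + v) y₂, ∀ z : ℂ,
      evalF F z * evalF H z = (z - y₂) • evalF F3 z + (z - y₁) • evalF F4 z := by
  obtain ⟨wF, eF⟩ := hF
  obtain ⟨wH, eH⟩ := hH
  obtain ⟨w3, e3⟩ := h3
  obtain ⟨A, B, C⟩ := F
  obtain ⟨A', B', C'⟩ := H
  obtain ⟨K, L, M⟩ := F3
  obtain ⟨pv, pc⟩ := prod_van wF wH
  have pl := prod_lead wF wH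
  have pe := prod_eps wF wH
  have expand : ∀ z : ℂ, A * A' + z • (A * B' + B * A') + z ^ 2 • (A * C' + B * B' + C * A')
      + z ^ 3 • (B * C' + C * B') = evalF (A, B, C) z * evalF (A', B', C') z := by
    intro z
    simp only [evalF, add_mul, mul_add, Matrix.smul_mul, Matrix.mul_smul, smul_add, smul_smul, pc]
    module
  have key := division (n := n) (d := d) (w := u + v) (y₁ := y₁) (y₂ := y₂)
    (N0 := A * A' + y₂ • K) (N1 := A * B' + B * A' - (K - y₂ • L))
    (N2 := A * C' + B * B' + C * A' - (L - y₂ • M)) (N3 := B * C' + C * B' - M) ?_ ?_ ?_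
  · obtain ⟨F4, h4, h5⟩ := key
    refine ⟨F4, h4, fun z => ?_⟩
    rw [← h5 z, ← expand z]
    simp only [evalF]
    module
  · obtain ⟨f1, f2⟩ := pv
    obtain ⟨k1, k2⟩ := w3
    simp only at f1 f2 k1 k2
    refine ⟨fun i j hi hj => ?_, fun i j hij => ?_⟩
    · have := f1 i j hi hj
      simp only [Matrix.sub_apply, Matrix.smul_apply, smul_eq_mul]
      rw [this, k1 i j hi hj, k2 i j (Or.inl hi)]; simp
    · have := f2 i j hij
      simp only [Matrix.sub_apply]
      rw [this, k2 i j hij]; simp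
  · rw [sub_lead _ _ _ _ _ _ _ w3, sub_eps, pl, pe]
    set X := Fzero n d (A, B, C)
    set Y := Fzero n d (A', B', C')
    set S := Fzero n d (K, L, M)
    set J := Jnd n d
    have e1 : Feps n d (A, B, C) = -(X * J - J * X) - (y₂ - v) • X := by
      rw [eq_sub_iff_add_eq, eq_neg_iff_add_eq_zero, ← eF]; abel
    have e2 : Feps n d (A', B', C') = -(Y * J - J * Y) - (y₁ - u) • Y := by
      rw [eq_sub_iff_add_eq, eq_neg_iff_add_eq_zero, ← eH]; abel
    have e3 : Feps n d (K, L, M) = -(S * J - J * S) - (y₁ - (u + v)) • S := by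
      rw [eq_sub_iff_add_eq, eq_neg_iff_add_eq_zero, ← e3]; abel
    rw [e1, e2, e3]
    simp only [mul_sub, sub_mul, mul_neg, neg_mul, Matrix.mul_smul, Matrix.smul_mul,
      Matrix.mul_assoc]
    module
  · have h1 := expand y₁
    rw [← hp] at h1
    simp only [evalF] at h1
    have h2 : A * A' + y₂ • K + y₁ • (A * B' + B * A' - (K - y₂ • L)) +
        y₁ ^ 2 • (A * C' + B * B' + C * A' - (L - y₂ • M)) + y₁ ^ 3 • (B * C' + C * B' - M) =
        (A * A' + y₁ • (A * B' + B * A') + y₁ ^ 2 • (A * C' + B * B' + C * A')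
      + y₁ ^ 3 • (B * C' + C * B')) - (y₁ - y₂) • (K + y₁ • L + y₁ ^ 2 • M) := by
      module
    rw [h2, h1, sub_self]


/-- Parametrization of `W_{n,d}` by pairs of matrices. -/
def phiW (n d : ℕ) : (Mat n × Mat n) →ₗ[ℂ] (Mat n × Mat n × Mat n) where
  toFun x := (x.1,
    Matrix.of fun i j => if (i : ℕ) < n - d ∧ ¬ (j : ℕ) < n - d then 0 else x.2 i j,
    Matrix.of fun i j => if ¬ (i : ℕ) < n - d ∧ (j : ℕ) < n - d then x.2 j i else 0)
  map_add' x y := by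
    ext i j
    · simp
    · simp only [Prod.snd_add, Prod.fst_add, Matrix.of_apply, Matrix.add_apply]
      split_ifs <;> simp
    · simp only [Prod.snd_add, Matrix.of_apply, Matrix.add_apply]
      split_ifs <;> simp
  map_smul' c x := by
    ext i j
    · simp
    · simp only [Prod.smul_snd, Prod.smul_fst, Matrix.of_apply, Matrix.smul_apply,
        RingHom.id_apply]
      split_ifs <;> simp
    · simp only [Prod.smul_snd, Matrix.of_apply, Matrix.smul_apply,
        RingHom.id_apply]
      split_ifs <;> simp

theorem phiW_mem (n d : ℕ) (x : Mat n × Mat n) : MemW n d (phiW n d x) := by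
  refine ⟨fun i j hi hj => ?_, fun i j hij => ?_⟩
  · simp only [phiW, LinearMap.coe_mk, AddHom.coe_mk, Matrix.of_apply]
    rw [if_pos ⟨hi, hj⟩]
  · simp only [phiW, LinearMap.coe_mk, AddHom.coe_mk, Matrix.of_apply]
    rw [if_neg (by tauto)]

theorem phiW_inj (n d : ℕ) (x : Mat n × Mat n) (h : phiW n d x = 0) : x = 0 := by
  have h1 : x.1 = 0 := congrArg Prod.fst h
  have h2 : ∀ i j, (phiW n d x).2.1 i j = 0 := by rw [h]; intro i j; rfl
  have h3 : ∀ i j, (phiW n d x).2.2 i j = 0 := by rw [h]; intro i j; rfl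
  simp only [phiW, LinearMap.coe_mk, AddHom.coe_mk, Matrix.of_apply] at h2 h3
  refine Prod.ext h1 ?_
  ext i j
  by_cases hij : (i : ℕ) < n - d ∧ ¬ (j : ℕ) < n - d
  · have := h3 j i
    rw [if_pos ⟨hij.2, hij.1⟩] at this
    exact this
  · have := h2 i j
    rw [if_neg hij] at this
    exact this

/-- `Fzero` as a linear map. -/
def FzeroL (n d : ℕ) : (Mat n × Mat n × Mat n) →ₗ[ℂ] Mat n where
  toFun := Fzero n d
  map_add' F G := by
    ext i j; simp only [Fzero, Matrix.of_apply, Prod.fst_add, Prod.snd_add, Matrix.add_apply]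
    split_ifs <;> simp
  map_smul' c F := by
    ext i j; simp only [Fzero, Matrix.of_apply, Prod.smul_fst, Prod.smul_snd, Matrix.smul_apply]
    split_ifs <;> simp

/-- `Feps` as a linear map. -/
def FepsL (n d : ℕ) : (Mat n × Mat n × Mat n) →ₗ[ℂ] Mat n where
  toFun := Feps n d
  map_add' F G := by
    ext i j; simp only [Feps, Matrix.of_apply, Prod.fst_add, Prod.snd_add, Matrix.add_apply]
    split_ifs <;> simp
  map_smul' c F := by
    ext i j; simp only [Feps, Matrix.of_apply, Prod.smul_fst, Prod.smul_snd, Matrix.smul_apply]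
    split_ifs <;> simp

/-- Constant part of the linear system. -/
def sysA0 (n d : ℕ) : (Mat n × Mat n) →ₗ[ℂ] (Mat n × Mat n) :=
  LinearMap.prod (LinearMap.fst ℂ _ _ ∘ₗ phiW n d)
    ((LinearMap.mulRight ℂ (Jnd n d) - LinearMap.mulLeft ℂ (Jnd n d)) ∘ₗ FzeroL n d ∘ₗ phiW n d
      + FepsL n d ∘ₗ phiW n d)

/-- Part of the linear system linear in `y`. -/
def sysA1 (n d : ℕ) : (Mat n × Mat n) →ₗ[ℂ] (Mat n × Mat n) :=
  LinearMap.prod (LinearMap.fst ℂ _ _ ∘ₗ LinearMap.snd ℂ _ _ ∘ₗ phiW n d) (FzeroL n d ∘ₗ phiW n d)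

/-- Part of the linear system quadratic in `y`. -/
def sysA2 (n d : ℕ) : (Mat n × Mat n) →ₗ[ℂ] (Mat n × Mat n) :=
  LinearMap.prod (LinearMap.snd ℂ _ _ ∘ₗ LinearMap.snd ℂ _ _ ∘ₗ phiW n d) 0

/-- Part of the linear system linear in `v`. -/
def sysA3 (n d : ℕ) : (Mat n × Mat n) →ₗ[ℂ] (Mat n × Mat n) :=
  LinearMap.prod 0 (FzeroL n d ∘ₗ phiW n d)

/-- A copy of `Mat n × Mat n` with its product topology. -/
abbrev PairFn (n : ℕ) : Type := (Fin n → Fin n → ℂ) × (Fin n → Fin n → ℂ)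

/-- The identification of `PairFn n` with pairs of matrices. -/
def pairEquiv (n : ℕ) : PairFn n ≃ₗ[ℂ] (Mat n × Mat n) :=
  (Matrix.ofLinearEquiv ℂ).prodCongr (Matrix.ofLinearEquiv ℂ)

/-- Transport of an endomorphism to `PairFn n`. -/
def conjE {n : ℕ} (f : (Mat n × Mat n) →ₗ[ℂ] (Mat n × Mat n)) : PairFn n →L[ℂ] PairFn n :=
  LinearMap.toContinuousLinearMap
    ((pairEquiv n).symm.toLinearMap ∘ₗ f ∘ₗ (pairEquiv n).toLinearMap)

theorem conjE_apply {n : ℕ} (f : (Mat n × Mat n) →ₗ[ℂ] (Mat n × Mat n)) (x : PairFn n) :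
    pairEquiv n (conjE f x) = f (pairEquiv n x) := by
  simp [conjE]

/-- The linear system whose solution is `res⁻¹`. -/
def sysM (n d : ℕ) (v y : ℂ) : PairFn n →L[ℂ] PairFn n :=
  conjE (sysA0 n d) + y • conjE (sysA1 n d) + y ^ 2 • conjE (sysA2 n d) - v • conjE (sysA3 n d)

theorem sysM_apply (n d : ℕ) (v y : ℂ) (x : PairFn n) :
    pairEquiv n (sysM n d v y x) = (evalF (phiW n d (pairEquiv n x)) y,
      (Fzero n d (phiW n d (pairEquiv n x)) * Jnd n d
          - Jnd n d * Fzero n d (phiW n d (pairEquiv n x)))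
        + (y - v) • Fzero n d (phiW n d (pairEquiv n x)) + Feps n d (phiW n d (pairEquiv n x))) := by
  have h0 : ∀ F, FzeroL n d F = Fzero n d F := fun _ => rfl
  have he : ∀ F, FepsL n d F = Feps n d F := fun _ => rfl
  have hs : pairEquiv n (sysM n d v y x) = sysA0 n d (pairEquiv n x)
      + y • sysA1 n d (pairEquiv n x) + y ^ 2 • sysA2 n d (pairEquiv n x)
      - v • sysA3 n d (pairEquiv n x) := by
    simp only [sysM, _root_.add_apply, _root_.sub_apply,
      _root_.smul_apply, map_add, map_sub, map_smul, conjE_apply]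
  rw [hs]
  refine Prod.ext ?_ ?_
  · simp [sysA0, sysA1, sysA2, sysA3, evalF]
  · simp [sysA0, sysA1, sysA2, sysA3, h0, he]
    module

theorem sysM_unit {n d : ℕ} (hd : 0 < d) (hdn : d < n) (hcop : Nat.Coprime n d) {v : ℂ}
    (hv : v ≠ 0) (y : ℂ) : IsUnit (sysM n d v y) := by
  have hinj : Function.Injective (sysM n d v y) := by
    rw [injective_iff_map_eq_zero]
    intro x hx
    have hx' := sysM_apply n d v y x
    rw [hx, map_zero, eq_comm, Prod.mk_eq_zero] at hx'
    have := phiW_inj n d _ (sol_zero hd hdn hcop (v := v) (y₁ := y)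
      ⟨phiW_mem n d (pairEquiv n x), hx'.2⟩ hx'.1 (by simpa using hv))
    simpa using this
  rw [ContinuousLinearMap.isUnit_iff_bijective]
  exact ⟨hinj, (LinearMap.injective_iff_surjective (f := (sysM n d v y).toLinearMap)).1 hinj⟩

/-- The solution with prescribed residue. -/
def solF (n d : ℕ) (v y : ℂ) (Z : Mat n) : Mat n × Mat n × Mat n :=
  phiW n d (pairEquiv n (Ring.inverse (sysM n d v y) ((pairEquiv n).symm (Z, 0))))

theorem solF_spec {n d : ℕ} (hd : 0 < d) (hdn : d < n) (hcop : Nat.Coprime n d) {v : ℂ}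
    (hv : v ≠ 0) (y : ℂ) (Z : Mat n) :
    solF n d v y Z ∈ SolSpace n d v y ∧ evalF (solF n d v y Z) y = Z := by
  have h : sysM n d v y (Ring.inverse (sysM n d v y) ((pairEquiv n).symm (Z, 0))) =
      (pairEquiv n).symm (Z, 0) := by
    have := Ring.mul_inverse_cancel _ (sysM_unit hd hdn hcop hv y)
    have := congrArg (fun f => f ((pairEquiv n).symm (Z, 0))) this
    simpa using this
  have h := congrArg (pairEquiv n) h
  rw [sysM_apply, LinearEquiv.apply_symm_apply, Prod.mk.injEq] at h
  exact ⟨⟨phiW_mem n d _, h.2⟩, h.1⟩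

theorem sysM_diff (n d : ℕ) :
    Differentiable ℂ (fun p : ℂ × ℂ × ℂ => sysM n d p.1 p.2.1) := by
  unfold sysM
  fun_prop

theorem solF_diff {n d : ℕ} (hd : 0 < d) (hdn : d < n) (hcop : Nat.Coprime n d) (Z : Mat n)
    (ℓ : (Mat n × Mat n × Mat n) →ₗ[ℂ] ℂ) {p : ℂ × ℂ × ℂ} (hp : p.1 ≠ 0) :
    DifferentiableAt ℂ (fun p : ℂ × ℂ × ℂ => ℓ (solF n d p.1 p.2.1 Z)) p := by
  have h1 : DifferentiableAt ℂ (fun p : ℂ × ℂ × ℂ => Ring.inverse (sysM n d p.1 p.2.1)) p :=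
    DifferentiableAt.comp (g := Ring.inverse) p
      (differentiableAt_inverse (𝕜 := ℂ) (sysM_unit hd hdn hcop hp p.2.1)) (sysM_diff n d p)
  have h2 : DifferentiableAt ℂ
      (fun p : ℂ × ℂ × ℂ => Ring.inverse (sysM n d p.1 p.2.1) ((pairEquiv n).symm (Z, 0))) p :=
    h1.clm_apply (differentiableAt_const _)
  exact ((LinearMap.toContinuousLinearMap
    (ℓ ∘ₗ phiW n d ∘ₗ (pairEquiv n).toLinearMap)).differentiableAt).comp p h2

theorem canMap_single {n : ℕ} (t : T2 n) (i j k l : Fin n) :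
    canMap t (Matrix.single j i 1) k l = t (i, k) (j, l) := by
  simp only [canMap, Matrix.of_apply, Matrix.single_apply]
  rw [Finset.sum_eq_single i, Finset.sum_eq_single j]
  · simp
  · intro b _ hb; simp [hb.symm]
  · simp
  · intro b _ hb; simp [hb.symm]
  · simp

/-- `canMap t` as a linear map. -/
def canL {n : ℕ} (t : T2 n) : Mat n →ₗ[ℂ] Mat n where
  toFun := canMap t
  map_add' x y := by
    ext k l; simp [canMap, mul_add, Finset.sum_add_distrib]
  map_smul' c x := by
    ext k l; simp [canMap, Finset.mul_sum, mul_left_comm]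

theorem canMap_single_mul {n : ℕ} (t : T2 n) (i j k l : Fin n) (M : Mat n) :
    canMap t (Matrix.single j i 1 * M) k l = ∑ m, M i m * t (m, k) (j, l) := by
  simp only [canMap, Matrix.of_apply]
  refine Finset.sum_congr rfl fun m _ => ?_
  rw [Finset.sum_eq_single j]
  · simp [mul_comm]
  · intro b _ hb; rw [Matrix.single_mul_apply_of_ne _ _ _ _ _ hb]; simp
  · simp

theorem canMap_mul_single {n : ℕ} (t : T2 n) (i j k l : Fin n) (M : Mat n) :
    canMap t (M * Matrix.single j i 1) k l = ∑ m, t (i, k) (m, l) * M m j := by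
  simp only [canMap, Matrix.of_apply]
  rw [Finset.sum_eq_single i]
  · simp
  · intro b _ hb
    refine Finset.sum_eq_zero fun m _ => ?_
    rw [Matrix.mul_single_apply_of_ne _ _ _ _ _ hb]; simp
  · simp

theorem emb_12_23 {n : ℕ} (s t : T2 n) (i₁ i₂ i₃ j₁ j₂ j₃ : Fin n) :
    (emb12 s * emb23 t) (i₁, i₂, i₃) (j₁, j₂, j₃) =
      ∑ m, s (i₁, i₂) (j₁, m) * t (m, i₃) (j₂, j₃) := by
  simp [Matrix.mul_apply, emb12, emb23, Fintype.sum_prod_type]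

theorem emb_13_12 {n : ℕ} (s t : T2 n) (i₁ i₂ i₃ j₁ j₂ j₃ : Fin n) :
    (emb13 s * emb12 t) (i₁, i₂, i₃) (j₁, j₂, j₃) =
      ∑ m, s (i₁, i₃) (m, j₃) * t (m, i₂) (j₁, j₂) := by
  simp [Matrix.mul_apply, emb12, emb13, Fintype.sum_prod_type]

theorem emb_23_13 {n : ℕ} (s t : T2 n) (i₁ i₂ i₃ j₁ j₂ j₃ : Fin n) :
    (emb23 s * emb13 t) (i₁, i₂, i₃) (j₁, j₂, j₃) =
      ∑ m, s (i₂, i₃) (j₂, m) * t (i₁, m) (j₁, j₃) := by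
  simp [Matrix.mul_apply, emb23, emb13, Fintype.sum_prod_type]

/-- For coprime `(n,d)` with `0 < d < n`, the tensor-valued function
`r_{(n,d)}(v;y₁,y₂) = can⁻¹(ev_{y₂} ∘ res_{y₁}⁻¹)` (characterized by
`can(r(v;y₁,y₂))(F(y₁)) = (y₂−y₁)⁻¹ F(y₂)` for all `F ∈ Sol_{n,d}^{v,y₁}`) is a
non-degenerate unitary solution of the AYBE, holomorphic on `ℂ³ ∖ V(v(y₁−y₂))`. -/
theorem r_nd_is_nondeg_unitary_aybe (n d : ℕ) (hd : 0 < d) (hdn : d < n)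
    (hcop : Nat.Coprime n d) (r : ℂ → ℂ → ℂ → T2 n)
    (hr : ∀ v y₁ y₂ : ℂ, v ≠ 0 → y₁ ≠ y₂ → ∀ F ∈ SolSpace n d v y₁,
      canMap (r v y₁ y₂) (evalF F y₁) = (y₂ - y₁)⁻¹ • evalF F y₂) :
    IsAYBESolution r ∧ IsUnitarySolution r ∧ IsNonDegenerate r ∧
      DifferentiableOn ℂ (fun p : ℂ × ℂ × ℂ => r p.1 p.2.1 p.2.2)
        {p : ℂ × ℂ × ℂ | p.1 * (p.2.1 - p.2.2) ≠ 0} := by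

  have hspec := fun {v : ℂ} (hv : v ≠ 0) (y : ℂ) (Z : Mat n) => solF_spec hd hdn hcop hv y Z
  have hent : ∀ v y₁ y₂ : ℂ, v ≠ 0 → y₁ ≠ y₂ → ∀ i j k l : Fin n, r v y₁ y₂ (i, k) (j, l) =
      (y₂ - y₁)⁻¹ * evalF (solF n d v y₁ (Matrix.single j i 1)) y₂ k l := by
    intro v y₁ y₂ hv hy i j k l
    obtain ⟨h1, h2⟩ := hspec hv y₁ (Matrix.single j i 1)
    have := hr v y₁ y₂ hv hy _ h1
    rw [h2] at this
    rw [← canMap_single (r v y₁ y₂) i j k l, this]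
    rfl
  have huni : IsUnitarySolution r := by
    intro v y₁ y₂ hv hy
    ext ⟨i, k⟩ ⟨j, l⟩
    simp only [tflip, Matrix.of_apply, Matrix.neg_apply]
    rw [hent (-v) y₂ y₁ (neg_ne_zero.2 hv) hy.symm, hent v y₁ y₂ hv hy]
    obtain ⟨h1, h2⟩ := hspec hv y₁ (Matrix.single j i 1)
    obtain ⟨h3, h4⟩ := hspec (neg_ne_zero.2 hv) y₂ (Matrix.single l k 1)
    have ht := sol_trace h1 h3
    rw [h2, h4, Matrix.trace_mul_comm, Matrix.trace_mul_single, Matrix.trace_mul_single] at ht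
    simp only [MulOpposite.op_one, one_smul, mul_one] at ht
    rw [ht, ← neg_sub y₂ y₁, inv_neg]
    ring
  refine ⟨?_, huni, ?_, ?_⟩
  · intro u v y₁ y₂ y₃ hu hv huv h12 h13 h23
    ext ⟨i₁, i₂, i₃⟩ ⟨j₁, j₂, j₃⟩
    rw [Matrix.add_apply, emb_12_23, emb_13_12, emb_23_13]
    obtain ⟨hH, hH1⟩ := hspec hu y₁ (Matrix.single j₁ i₁ 1)
    obtain ⟨hF, hF1⟩ := hspec hv y₂ (Matrix.single j₂ i₂ 1)
    have t0 : ∀ m, r u y₁ y₂ (i₁, i₂) (j₁, m) = _ := fun m => hent u y₁ y₂ hu h12 i₁ j₁ i₂ m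
    have t1 : ∀ m, r (-v) y₁ y₂ (m, i₂) (j₁, j₂) =
        -((y₁ - y₂)⁻¹ * evalF (solF n d v y₂ (Matrix.single j₂ i₂ 1)) y₁ m j₁) := fun m => by
      have h := congrFun (congrFun (huni v y₂ y₁ hv h12.symm) (i₂, m)) (j₂, j₁)
      simp only [tflip, Matrix.of_apply, Matrix.neg_apply] at h
      rw [hent v y₂ y₁ hv h12.symm] at h
      exact h
    have t2 : ∀ m, r v y₂ y₃ (i₂, i₃) (j₂, m) = _ := fun m => hent v y₂ y₃ hv h23 i₂ j₂ i₃ m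
    have t3 : ∀ m, r u y₁ y₃ (i₁, m) (j₁, j₃) = _ := fun m => hent u y₁ y₃ hu h13 i₁ j₁ m j₃
    simp only [t0, t1, t2, t3]
    set H := solF n d u y₁ (Matrix.single j₁ i₁ 1)
    set F := solF n d v y₂ (Matrix.single j₂ i₂ 1)
    have d12 : y₁ - y₂ ≠ 0 := sub_ne_zero.2 h12
    have d21 : y₂ - y₁ ≠ 0 := sub_ne_zero.2 h12.symm
    have d31 : y₃ - y₁ ≠ 0 := sub_ne_zero.2 h13.symm
    have d32 : y₃ - y₂ ≠ 0 := sub_ne_zero.2 h23.symm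
    obtain ⟨h3, h31⟩ := hspec huv y₁ ((y₁ - y₂)⁻¹ • (evalF F y₁ * Matrix.single j₁ i₁ 1))
    set F3 := solF n d (u + v) y₁ ((y₁ - y₂)⁻¹ • (evalF F y₁ * Matrix.single j₁ i₁ 1))
    obtain ⟨F4, h4, hprod⟩ := sol_prod hF hH h3 (by
      rw [h31, smul_smul, mul_inv_cancel₀ d12, one_smul, hH1])
    have h41 : evalF F4 y₂ = (y₂ - y₁)⁻¹ • (Matrix.single j₂ i₂ 1 * evalF H y₂) := by
      have := hprod y₂
      rw [hF1, sub_self, zero_smul, zero_add] at this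
      rw [this, smul_smul, inv_mul_cancel₀ d21, one_smul]
    have c4 := hr (u + v) y₂ y₃ huv h23 F4 h4
    have c3 := hr (u + v) y₁ y₃ huv h13 F3 h3
    rw [h41] at c4
    rw [h31] at c3
    have c4' : (y₂ - y₁)⁻¹ • canMap (r (u + v) y₂ y₃) (Matrix.single j₂ i₂ 1 * evalF H y₂) =
        (y₃ - y₂)⁻¹ • evalF F4 y₃ := by
      rw [← c4]; exact ((canL _).map_smul _ _).symm
    have c3' : (y₁ - y₂)⁻¹ • canMap (r (u + v) y₁ y₃) (evalF F y₁ * Matrix.single j₁ i₁ 1) =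
        (y₃ - y₁)⁻¹ • evalF F3 y₃ := by
      rw [← c3]; exact ((canL _).map_smul _ _).symm
    have e4 := congrFun (congrFun c4' i₃) j₃
    have e3 := congrFun (congrFun c3' i₃) j₃
    have ep := congrFun (congrFun (hprod y₃) i₃) j₃
    simp only [Matrix.smul_apply, Matrix.add_apply, smul_eq_mul] at e4 e3 ep
    rw [canMap_single_mul, Finset.mul_sum] at e4
    rw [canMap_mul_single, Finset.mul_sum] at e3
    rw [Matrix.mul_apply] at ep
    have s1 : ∑ m, (y₂ - y₁)⁻¹ * evalF H y₂ i₂ m * r (u + v) y₂ y₃ (m, i₃) (j₂, j₃) =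
        (y₃ - y₂)⁻¹ * evalF F4 y₃ i₃ j₃ := by
      rw [← e4]; exact Finset.sum_congr rfl fun m _ => by ring
    have s2 : ∑ m, r (u + v) y₁ y₃ (i₁, i₃) (m, j₃) * -((y₁ - y₂)⁻¹ * evalF F y₁ m j₁) =
        - ((y₃ - y₁)⁻¹ * evalF F3 y₃ i₃ j₃) := by
      rw [← e3, ← Finset.sum_neg_distrib]; exact Finset.sum_congr rfl fun m _ => by ring
    have s3 : ∑ m, (y₃ - y₂)⁻¹ * evalF F y₃ i₃ m * ((y₃ - y₁)⁻¹ * evalF H y₃ m j₃) =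
        (y₃ - y₂)⁻¹ * (y₃ - y₁)⁻¹ * ((y₃ - y₂) * evalF F3 y₃ i₃ j₃
          + (y₃ - y₁) * evalF F4 y₃ i₃ j₃) := by
      rw [← ep, Finset.mul_sum]; exact Finset.sum_congr rfl fun m _ => by ring
    rw [s1, s2, s3]
    field_simp
    ring
  · rintro ⟨v, y₁, y₂⟩ ⟨hv, hy⟩
    simp only at hv hy
    have hdense : Dense ({0, y₁ - y₂} : Set ℂ)ᶜ :=
      Set.Countable.dense_compl ℂ ((Set.toFinite _).countable)
    refine map_mem_closure (f := fun w : ℂ => (w, y₁, y₂)) (by fun_prop) (hdense v) ?_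
    intro w hw
    simp only [mem_compl_iff, mem_insert_iff, mem_singleton_iff, not_or] at hw
    obtain ⟨hw0, hw1⟩ := hw
    refine ⟨hw0, hy, ?_⟩
    have hinj : Function.Injective (canL (r w y₁ y₂)) := by
      rw [injective_iff_map_eq_zero]
      intro Z hZ
      obtain ⟨h1, h2⟩ := hspec hw0 y₁ Z
      have := hr w y₁ y₂ hw0 hy _ h1
      rw [h2] at this
      have hZ' : canMap (r w y₁ y₂) Z = 0 := hZ
      rw [hZ', eq_comm, smul_eq_zero] at this
      have h3 := this.resolve_left (inv_ne_zero (sub_ne_zero.2 hy.symm))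
      have h4 := sol_zero hd hdn hcop h1 h3 (fun h => hw1 (by linear_combination h))
      rw [← h2, h4]
      simp [evalF]
    exact ⟨hinj, LinearMap.injective_iff_surjective.1 hinj⟩
  · intro p hp
    apply DifferentiableAt.differentiableWithinAt
    have hp1 : p.1 ≠ 0 := left_ne_zero_of_mul hp
    have hp2 : p.2.1 ≠ p.2.2 := sub_ne_zero.1 (right_ne_zero_of_mul hp)
    refine differentiableAt_pi.2 fun ik => differentiableAt_pi.2 fun jl => ?_
    obtain ⟨i, k⟩ := ik
    obtain ⟨j, l⟩ := jl
    have hopen : ∀ᶠ q : ℂ × ℂ × ℂ in 𝓝 p, q.1 ≠ 0 ∧ q.2.1 ≠ q.2.2 :=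
      (ContinuousAt.eventually_ne (by fun_prop) hp1).and
        ((isOpen_ne_fun (by fun_prop) (by fun_prop)).mem_nhds hp2)
    refine DifferentiableAt.congr_of_eventuallyEq (f := fun q : ℂ × ℂ × ℂ =>
      (q.2.2 - q.2.1)⁻¹ * evalF (solF n d q.1 q.2.1 (Matrix.single j i 1)) q.2.2 k l) ?_
      (hopen.mono fun q hq => hent q.1 q.2.1 q.2.2 hq.1 hq.2 i j k l)
    have g1 := solF_diff hd hdn hcop (Matrix.single j i 1)
      (Matrix.entryLinearMap ℂ ℂ k l ∘ₗ LinearMap.fst ℂ _ _) hp1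
    have g2 := solF_diff hd hdn hcop (Matrix.single j i 1)
      (Matrix.entryLinearMap ℂ ℂ k l ∘ₗ LinearMap.fst ℂ _ _ ∘ₗ LinearMap.snd ℂ _ _) hp1
    have g3 := solF_diff hd hdn hcop (Matrix.single j i 1)
      (Matrix.entryLinearMap ℂ ℂ k l ∘ₗ LinearMap.snd ℂ _ _ ∘ₗ LinearMap.snd ℂ _ _) hp1
    have hy : DifferentiableAt ℂ (fun q : ℂ × ℂ × ℂ => q.2.2) p := by fun_prop
    have hi : DifferentiableAt ℂ (fun q : ℂ × ℂ × ℂ => (q.2.2 - q.2.1)⁻¹) p := by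
      refine DifferentiableAt.inv (by fun_prop) ?_
      exact sub_ne_zero.2 hp2.symm
    exact hi.mul ((g1.add (hy.mul g2)).add ((hy.pow 2).mul g3))
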